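/- arXiv:1811.09256 — 2 statements merged into one kernel-verified Lean document; each statement's English description precedes it below -/
import Mathlib

section
/- Let α > 0 and T > 0. Let u, a : [0,T] → ℝ be integrable and nonnegative with a nondecreasing, and let g : [0,T] → ℝ be continuous, nonnegative and nondecreasing. If u(t) ≤ a(t) + g(t) ∫_0^t (t − s)^{α−1} u(s) ds for all t ∈ [0,T], then u(t) ≤ a(t) · E_α( g(t) Γ(α) t^α ) for all t ∈ [0,T]. -/
open MeasureTheory

/-- The Mittag-Leffler function `E_α(z) = ∑_{k=0}^∞ z^k / Γ(αk + 1)`. -/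
noncomputable def mittagLeffler (α z : ℝ) : ℝ :=
  ∑' k : ℕ, z ^ k / Real.Gamma (α * k + 1)

open Set Filter Topology
open scoped ENNReal

/-- The density `x ^ (β - 1) / Γ(β)` of the Riemann–Liouville integral of order `β`, extended by
zero to `x ≤ 0`. -/
noncomputable def rlKernel (β x : ℝ) : ℝ≥0∞ :=
  if 0 < x then ENNReal.ofReal (x ^ (β - 1) / Real.Gamma β) else 0

lemma rlKernel_of_pos (β : ℝ) {x : ℝ} (hx : 0 < x) :
    rlKernel β x = ENNReal.ofReal (x ^ (β - 1) / Real.Gamma β) := if_pos hx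

lemma rlKernel_of_nonpos (β : ℝ) {x : ℝ} (hx : x ≤ 0) : rlKernel β x = 0 := if_neg hx.not_gt

lemma rlKernel_one_of_pos {x : ℝ} (hx : 0 < x) : rlKernel 1 x = 1 := by
  simp [rlKernel_of_pos 1 hx]

@[fun_prop]
lemma measurable_rlKernel (β : ℝ) : Measurable (rlKernel β) :=
  Measurable.ite measurableSet_Ioi (by fun_prop) measurable_const

lemma rlKernel_mono {β : ℝ} (hβ : 1 ≤ β) : Monotone (rlKernel β) := by
  intro x y hxy
  rcases le_or_gt x 0 with hx | hx
  · simp [rlKernel_of_nonpos β hx]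
  · rw [rlKernel_of_pos β hx, rlKernel_of_pos β (hx.trans_le hxy)]
    have := Real.Gamma_pos_of_pos (zero_lt_one.trans_le hβ)
    gcongr

/-- Semigroup property of the Riemann–Liouville kernels. -/
lemma rlKernel_lconvolution_rlKernel {β γ : ℝ} (hβ : 0 < β) (hγ : 0 < γ) :
    rlKernel β ⋆ₗ rlKernel γ = rlKernel (β + γ) := by
  ext x
  rw [lconvolution_def]
  rcases le_or_gt x 0 with hx | hx
  · rw [rlKernel_of_nonpos _ hx]
    refine (lintegral_congr fun y => ?_).trans lintegral_zero
    rcases le_or_gt y 0 with hy | hy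
    · simp [rlKernel_of_nonpos _ hy]
    · simp [rlKernel_of_nonpos γ (show -y + x ≤ 0 by linarith)]
  have hβγ := Real.Gamma_pos_of_pos (add_pos hβ hγ)
  have hΓβ := Real.Gamma_pos_of_pos hβ
  have hΓγ := Real.Gamma_pos_of_pos hγ
  have hbeta := ProbabilityTheory.beta_pos hβ hγ
  have key : ∀ y, rlKernel β y * rlKernel γ (-y + x) =
      ENNReal.ofReal (x ^ (β + γ - 2) / Real.Gamma (β + γ)) *
        ProbabilityTheory.betaPDF β γ (x⁻¹ * y) := by
    intro y
    rcases le_or_gt y 0 with hy | hy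
    · rw [rlKernel_of_nonpos _ hy, ProbabilityTheory.betaPDF_eq_zero_of_nonpos, zero_mul, mul_zero]
      exact mul_nonpos_of_nonneg_of_nonpos (inv_nonneg.2 hx.le) hy
    rcases le_or_gt x y with hxy | hxy
    · rw [rlKernel_of_nonpos γ (show -y + x ≤ 0 by linarith),
        ProbabilityTheory.betaPDF_eq_zero_of_one_le, mul_zero, mul_zero]
      rwa [inv_mul_eq_div, one_le_div hx]
    · have hxy' : 0 < x - y := sub_pos.2 hxy
      rw [rlKernel_of_pos β hy, neg_add_eq_sub, rlKernel_of_pos γ hxy',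
        ProbabilityTheory.betaPDF_of_pos_lt_one (by positivity)
          (by rwa [inv_mul_eq_div, div_lt_one hx]),
        ← ENNReal.ofReal_mul (by positivity), ← ENNReal.ofReal_mul (by positivity)]
      congr 1
      have h1 : 1 - x⁻¹ * y = (x - y) / x := by field_simp
      rw [h1, inv_mul_eq_div, Real.div_rpow hy.le hx.le, Real.div_rpow hxy'.le hx.le,
        show β + γ - 2 = (β - 1) + (γ - 1) by ring, Real.rpow_add hx, ProbabilityTheory.beta]
      have := Real.rpow_pos_of_pos hx (β - 1)
      have := Real.rpow_pos_of_pos hx (γ - 1)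
      field_simp
  have hscale : ∫⁻ y, ProbabilityTheory.betaPDF β γ (x⁻¹ * y) = ENNReal.ofReal x := by
    have hm : Measurable (ProbabilityTheory.betaPDF β γ) :=
      (ProbabilityTheory.measurable_betaPDFReal β γ).ennreal_ofReal
    rw [← lintegral_map hm (by fun_prop), Real.map_volume_mul_left (inv_ne_zero hx.ne'),
      lintegral_smul_measure, ProbabilityTheory.lintegral_betaPDF_eq_one hβ hγ, inv_inv,
      abs_of_pos hx, smul_eq_mul, mul_one]
  simp_rw [key]
  rw [lintegral_const_mul' _ _ ENNReal.ofReal_ne_top, hscale, rlKernel_of_pos _ hx,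
    ← ENNReal.ofReal_mul (by positivity)]
  congr 1
  rw [show β + γ - 1 = (β + γ - 2) + 1 by ring, Real.rpow_add hx, Real.rpow_one]
  ring

lemma rpow_mul_exp_neg_le_Gamma {R x : ℝ} (hR : 0 < R) (hx : 0 ≤ x) :
    R ^ x * Real.exp (-R) ≤ Real.Gamma (x + 1) := by
  have hΓ_int := Real.GammaIntegral_convergent (show 0 < x + 1 by linarith)
  rw [Real.Gamma_eq_integral (by linarith), ← integral_exp_neg_Ioi, ← integral_const_mul]
  calc ∫ y in Ioi R, R ^ x * Real.exp (-y)
      ≤ ∫ y in Ioi R, Real.exp (-y) * y ^ (x + 1 - 1) := by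
        refine setIntegral_mono_on ((integrableOn_exp_neg_Ioi R).const_mul _)
          (hΓ_int.mono_set (Ioi_subset_Ioi hR.le)) measurableSet_Ioi fun y hy => ?_
        rw [mul_comm, add_sub_cancel_right]
        have : R ≤ y := le_of_lt hy
        gcongr
    _ ≤ ∫ y in Ioi 0, Real.exp (-y) * y ^ (x + 1 - 1) := by
        refine setIntegral_mono_set hΓ_int ?_ (Ioi_subset_Ioi hR.le).eventuallyLE
        filter_upwards [ae_restrict_mem measurableSet_Ioi] with y hy
        have : 0 < y := hy
        positivity

/-- The two-parameter Mittag-Leffler series converges. -/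
lemma summable_pow_div_Gamma {α c z : ℝ} (hα : 0 < α) (hc : 0 ≤ c) (hz : 0 ≤ z) :
    Summable fun k : ℕ => z ^ k / Real.Gamma (α * k + c + 1) := by
  set w := 2 * z + 1
  have hw : 0 < w := by positivity
  set R := w ^ α⁻¹
  have hR : 0 < R := by positivity
  have hRw : R ^ α = w := by
    rw [← Real.rpow_mul hw.le, inv_mul_cancel₀ hα.ne', Real.rpow_one]
  have hsum : Summable fun k : ℕ => (z / w) ^ k * (Real.exp R / R ^ c) :=
    (summable_geometric_of_lt_one (by positivity)
      ((div_lt_one hw).2 (by linarith))).mul_right _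
  refine Summable.of_nonneg_of_le (fun k => ?_) (fun k => ?_) hsum
  · have := Real.Gamma_pos_of_pos (show 0 < α * k + c + 1 by positivity)
    positivity
  · have h := rpow_mul_exp_neg_le_Gamma hR (show 0 ≤ α * k + c by positivity)
    calc z ^ k / Real.Gamma (α * k + c + 1) ≤ z ^ k / (R ^ (α * k + c) * Real.exp (-R)) := by
          gcongr
      _ = (z / w) ^ k * (Real.exp R / R ^ c) := by
          rw [Real.rpow_add hR, Real.rpow_mul hR.le, hRw, Real.rpow_natCast, Real.exp_neg]
          rw [div_pow]
          field_simp

lemma lconvolution_rlKernel_le {β t : ℝ} (hβ : 1 ≤ β) {V : ℝ → ℝ≥0∞}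
    (hV : ∀ s ≤ 0, V s = 0) : (rlKernel β ⋆ₗ V) t ≤ rlKernel β t * ∫⁻ s, V s := by
  rw [lconvolution_def]
  calc ∫⁻ y, rlKernel β y * V (-y + t) ≤ ∫⁻ y, rlKernel β t * V (t - y) := by
        refine lintegral_mono fun y => ?_
        rw [neg_add_eq_sub]
        rcases le_or_gt y t with hy | hy
        · gcongr
          exact rlKernel_mono hβ hy
        · simp [hV (t - y) (by linarith)]
    _ = rlKernel β t * ∫⁻ s, V s := by
        have hfin : rlKernel β t ≠ ∞ := by
          unfold rlKernel; split_ifs <;> simp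
        rw [lintegral_const_mul' _ _ hfin, lintegral_sub_left_eq_self]

/-- Finite iteration of a Volterra inequality with Riemann–Liouville kernel. -/
lemma le_sum_add_lconvolution_rlKernel {α : ℝ} (hα : 0 < α) {V : ℝ → ℝ≥0∞}
    (hVm : AEMeasurable V) {A c : ℝ≥0∞}
    (hV : ∀ s, V s ≤ A * rlKernel 1 s + c * (rlKernel α ⋆ₗ V) s) (t : ℝ) (n : ℕ) :
    V t ≤ A * ∑ k ∈ Finset.range (n + 1), c ^ k * rlKernel (α * k + 1) t +
      c ^ (n + 1) * (rlKernel (α * (n + 1 : ℕ)) ⋆ₗ V) t := by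
  induction n with
  | zero => simpa using hV t
  | succ n ih =>
    have hβ : 0 < α * (n + 1 : ℕ) := by positivity
    set β := α * (n + 1 : ℕ)
    have hconv : AEMeasurable (rlKernel α ⋆ₗ V) :=
      aemeasurable_lconvolution (measurable_rlKernel α).aemeasurable hVm
    have step : (rlKernel β ⋆ₗ V) t ≤
        A * rlKernel (β + 1) t + c * (rlKernel (α * (n + 1 + 1 : ℕ)) ⋆ₗ V) t := by
      have hβ' : α * (n + 1 + 1 : ℕ) = β + α := by simp only [β]; push_cast; ring
      rw [hβ', ← rlKernel_lconvolution_rlKernel hβ one_pos, ← rlKernel_lconvolution_rlKernel hβ hα,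
        ← lconvolution_assoc₀ (measurable_rlKernel β).aemeasurable
          (measurable_rlKernel α).aemeasurable hVm]
      simp only [lconvolution_def (f := rlKernel β)]
      have hq : Measure.QuasiMeasurePreserving (fun y : ℝ => -y + t) := by
        simpa [neg_add_eq_sub] using
          (Measure.measurePreserving_sub_left (volume : Measure ℝ) t).quasiMeasurePreserving
      have hconv' : AEMeasurable fun y => (rlKernel α ⋆ₗ V) (-y + t) :=
        hconv.comp_quasiMeasurePreserving hq
      rw [← lintegral_const_mul'' _ (by fun_prop), ← lintegral_const_mul'' _ (by fun_prop),
        ← lintegral_add_left' (by fun_prop)]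
      refine lintegral_mono fun y => ?_
      calc rlKernel β y * V (-y + t)
          ≤ rlKernel β y * (A * rlKernel 1 (-y + t) + c * (rlKernel α ⋆ₗ V) (-y + t)) := by
            gcongr
            exact hV _
        _ = _ := by ring
    calc V t ≤ _ := ih
      _ ≤ A * ∑ k ∈ Finset.range (n + 1), c ^ k * rlKernel (α * k + 1) t +
          c ^ (n + 1) * (A * rlKernel (β + 1) t +
            c * (rlKernel (α * (n + 1 + 1 : ℕ)) ⋆ₗ V) t) := by gcongr
      _ = _ := by
        rw [Finset.sum_range_succ _ (n + 1)]
        ring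

lemma ofReal_pow_mul_rlKernel {α c t : ℝ} (hc : 0 ≤ c) (ht : 0 < t) (k : ℕ) :
    ENNReal.ofReal c ^ k * rlKernel (α * k + 1) t =
      ENNReal.ofReal ((c * t ^ α) ^ k / Real.Gamma (α * k + 1)) := by
  rw [rlKernel_of_pos _ ht, ← ENNReal.ofReal_pow hc, ← ENNReal.ofReal_mul (by positivity),
    add_sub_cancel_right, Real.rpow_mul ht.le, Real.rpow_natCast, mul_pow, mul_div_assoc]

lemma tendsto_pow_mul_rlKernel {α c t : ℝ} (hα : 0 < α) (hc : 0 ≤ c) (ht : 0 < t) :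
    Tendsto (fun n : ℕ => ENNReal.ofReal c ^ n * rlKernel (α * n) t) atTop (𝓝 0) := by
  obtain ⟨N, hN⟩ := exists_nat_ge α⁻¹
  have hN' : 1 ≤ α * N := by
    rwa [inv_le_iff_one_le_mul₀' hα] at hN
  rw [← tendsto_add_atTop_iff_nat N]
  have hz : 0 ≤ c * t ^ α := by positivity
  have h := ((summable_pow_div_Gamma hα (sub_nonneg.2 hN') hz).tendsto_atTop_zero).mul_const
    ((c * t ^ α) ^ N / t)
  rw [zero_mul] at h
  have h' := ENNReal.tendsto_ofReal h
  rw [ENNReal.ofReal_zero] at h'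
  refine h'.congr fun n => ?_
  rw [rlKernel_of_pos _ ht, ← ENNReal.ofReal_pow hc, ← ENNReal.ofReal_mul (by positivity)]
  congr 1
  rw [show α * n + (α * N - 1) + 1 = α * (n + N : ℕ) by push_cast; ring, Real.rpow_sub ht,
    Real.rpow_one, Real.rpow_mul ht.le, Real.rpow_natCast, pow_add (t ^ α), mul_pow, mul_pow,
    pow_add c]
  ring

/-- Gronwall inequality for convolution with the Riemann–Liouville kernel. -/
lemma le_mittagLeffler_of_le_lconvolution {α c t : ℝ} (hα : 0 < α) (hc : 0 ≤ c) (ht : 0 < t)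
    {V : ℝ → ℝ≥0∞} (hVm : AEMeasurable V) (hV_int : ∫⁻ s, V s ≠ ∞) (hV_zero : ∀ s ≤ 0, V s = 0)
    {A : ℝ≥0∞}
    (hV : ∀ s, V s ≤ A * rlKernel 1 s + ENNReal.ofReal c * (rlKernel α ⋆ₗ V) s) :
    V t ≤ A * ENNReal.ofReal (mittagLeffler α (c * t ^ α)) := by
  have hz : 0 ≤ c * t ^ α := by positivity
  have hterm : ∀ k : ℕ, 0 ≤ (c * t ^ α) ^ k / Real.Gamma (α * k + 1) := fun k => by
    have := Real.Gamma_pos_of_pos (show 0 < α * k + 1 by positivity)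
    positivity
  have hsum : Summable fun k : ℕ => (c * t ^ α) ^ k / Real.Gamma (α * k + 1) := by
    simpa using summable_pow_div_Gamma hα le_rfl hz
  have hlim : Tendsto (fun n : ℕ => A * ENNReal.ofReal (mittagLeffler α (c * t ^ α)) +
      ENNReal.ofReal c ^ (n + 1) * rlKernel (α * (n + 1 : ℕ)) t * ∫⁻ s, V s) atTop
      (𝓝 (A * ENNReal.ofReal (mittagLeffler α (c * t ^ α)) + 0 * ∫⁻ s, V s)) :=
    (ENNReal.Tendsto.mul_const ((tendsto_pow_mul_rlKernel hα hc ht).comp (tendsto_add_atTop_nat 1))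
      (Or.inr hV_int)).const_add _
  rw [zero_mul, add_zero] at hlim
  obtain ⟨N, hN⟩ := exists_nat_ge α⁻¹
  refine ge_of_tendsto hlim ?_
  filter_upwards [eventually_ge_atTop N] with n hn
  have hβ : 1 ≤ α * (n + 1 : ℕ) := by
    rw [inv_le_iff_one_le_mul₀' hα] at hN
    refine hN.trans ?_
    gcongr
    omega
  refine (le_sum_add_lconvolution_rlKernel hα hVm hV t n).trans ?_
  rw [mul_assoc (ENNReal.ofReal c ^ (n + 1))]
  gcongr
  · simp_rw [ofReal_pow_mul_rlKernel hc ht]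
    rw [← ENNReal.ofReal_sum_of_nonneg fun k _ => hterm k]
    exact ENNReal.ofReal_le_ofReal (hsum.sum_le_tsum _ fun k _ => hterm k)
  · exact lconvolution_rlKernel_le hβ hV_zero

lemma one_le_mittagLeffler {α z : ℝ} (hα : 0 < α) (hz : 0 ≤ z) : 1 ≤ mittagLeffler α z := by
  have hsum : Summable fun k : ℕ => z ^ k / Real.Gamma (α * k + 1) := by
    simpa using summable_pow_div_Gamma hα le_rfl hz
  refine le_trans (by simp) (hsum.le_tsum 0 fun k _ => ?_)
  have := Real.Gamma_pos_of_pos (show 0 < α * k + 1 by positivity)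
  positivity

/-- The Riemann–Liouville integral of `u` up to `s ≤ t` is bounded by the convolution of the kernel
with the truncation of `u` to `(0, t]`. -/
lemma ofReal_intervalIntegral_le_lconvolution {α s t : ℝ} (hα : 0 < α) (hs : 0 ≤ s) (hst : s ≤ t)
    {u : ℝ → ℝ} (hu : ∀ r ∈ Ioc 0 t, 0 ≤ u r) :
    ENNReal.ofReal (∫ r in (0 : ℝ)..s, (s - r) ^ (α - 1) * u r) ≤
      ENNReal.ofReal (Real.Gamma α) *
        (rlKernel α ⋆ₗ (Ioc 0 t).indicator fun r => ENNReal.ofReal (u r)) s := by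
  have hΓ := Real.Gamma_pos_of_pos hα
  rw [lconvolution_comm, lconvolution_def, intervalIntegral.integral_of_le hs,
    integral_Ioc_eq_integral_Ioo, ← lintegral_const_mul' _ _ ENNReal.ofReal_ne_top]
  refine ((Real.ofReal_le_enorm _).trans (enorm_integral_le_lintegral_enorm _)).trans
    (le_trans ?_ (setLIntegral_le_lintegral (Ioo 0 s) _))
  refine setLIntegral_mono' measurableSet_Ioo fun r hr => ?_
  have hrs : 0 < s - r := sub_pos.2 hr.2
  have hrt : r ∈ Ioc 0 t := ⟨hr.1, hr.2.le.trans hst⟩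
  have hur := hu r hrt
  rw [indicator_of_mem hrt, neg_add_eq_sub, rlKernel_of_pos _ hrs,
    Real.enorm_of_nonneg (by positivity), ← ENNReal.ofReal_mul hur, ← ENNReal.ofReal_mul hΓ.le]
  refine ENNReal.ofReal_le_ofReal (le_of_eq ?_)
  field_simp

/-- Fractional Gronwall inequality on `[0,T]` with Riemann–Liouville kernel:
    Mittag-Leffler bound. -/
theorem fractional_gronwall_mittagLeffler
    (α T : ℝ) (hα : 0 < α) (hT : 0 < T)
    (u a g : ℝ → ℝ)
    (hu_int : IntegrableOn u (Set.Icc 0 T))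
    (ha_int : IntegrableOn a (Set.Icc 0 T))
    (hu_nonneg : ∀ t ∈ Set.Icc (0 : ℝ) T, 0 ≤ u t)
    (ha_nonneg : ∀ t ∈ Set.Icc (0 : ℝ) T, 0 ≤ a t)
    (ha_mono : MonotoneOn a (Set.Icc (0 : ℝ) T))
    (hg_cont : ContinuousOn g (Set.Icc 0 T))
    (hg_nonneg : ∀ t ∈ Set.Icc (0 : ℝ) T, 0 ≤ g t)
    (hg_mono : MonotoneOn g (Set.Icc (0 : ℝ) T))
    (hineq : ∀ t ∈ Set.Icc (0 : ℝ) T,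
      u t ≤ a t + g t * ∫ s in (0 : ℝ)..t, (t - s) ^ (α - 1) * u s) :
    ∀ t ∈ Set.Icc (0 : ℝ) T,
      u t ≤ a t * mittagLeffler α (g t * Real.Gamma α * t ^ α) := by
  intro t ht
  have hΓ := Real.Gamma_pos_of_pos hα
  have hgt := hg_nonneg t ht
  have hat := ha_nonneg t ht
  have hc : 0 ≤ g t * Real.Gamma α := by positivity
  have hz : 0 ≤ g t * Real.Gamma α * t ^ α := mul_nonneg hc (Real.rpow_nonneg ht.1 α)
  rcases ht.1.eq_or_lt with rfl | ht0
  · have h0 := hineq 0 ht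
    rw [intervalIntegral.integral_same, mul_zero, add_zero] at h0
    exact h0.trans (le_mul_of_one_le_right hat (one_le_mittagLeffler hα hz))
  have hsub : Ioc 0 t ⊆ Icc 0 T := fun s hs => ⟨hs.1.le, hs.2.trans ht.2⟩
  have hu_int' : IntegrableOn u (Ioc 0 t) := hu_int.mono_set hsub
  set V : ℝ → ℝ≥0∞ := (Ioc 0 t).indicator fun r => ENNReal.ofReal (u r) with hV_def
  have hVm : AEMeasurable V :=
    (aemeasurable_indicator_iff measurableSet_Ioc).2 hu_int'.aemeasurable.ennreal_ofReal
  have hV_int : ∫⁻ s, V s ≠ ∞ := by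
    rw [hV_def, lintegral_indicator measurableSet_Ioc]
    exact ((lintegral_ofReal_le_lintegral_enorm u).trans_lt hu_int'.2).ne
  have hV_zero : ∀ s ≤ 0, V s = 0 := fun s hs => indicator_of_notMem (fun h => h.1.not_ge hs) _
  have hV : ∀ s, V s ≤ ENNReal.ofReal (a t) * rlKernel 1 s +
      ENNReal.ofReal (g t * Real.Gamma α) * (rlKernel α ⋆ₗ V) s := by
    intro s
    by_cases hs : s ∈ Ioc 0 t
    · have hsT := hsub hs
      have hgs := hg_nonneg s hsT
      rw [hV_def, indicator_of_mem hs, rlKernel_one_of_pos hs.1, mul_one, ← hV_def]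
      calc ENNReal.ofReal (u s)
          ≤ ENNReal.ofReal (a s) + ENNReal.ofReal (g s) *
              ENNReal.ofReal (∫ r in (0 : ℝ)..s, (s - r) ^ (α - 1) * u r) := by
            rw [← ENNReal.ofReal_mul hgs]
            exact (ENNReal.ofReal_le_ofReal (hineq s hsT)).trans ENNReal.ofReal_add_le
        _ ≤ ENNReal.ofReal (a t) + ENNReal.ofReal (g t) *
              (ENNReal.ofReal (Real.Gamma α) * (rlKernel α ⋆ₗ V) s) := by
            gcongr
            · exact ha_mono hsT ht hs.2
            · exact hg_mono hsT ht hs.2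
            · exact ofReal_intervalIntegral_le_lconvolution hα hs.1.le hs.2
                fun r hr => hu_nonneg r (hsub hr)
        _ = _ := by rw [ENNReal.ofReal_mul hgt, mul_assoc]
    · rw [hV_def, indicator_of_notMem hs]
      exact zero_le
  have key := le_mittagLeffler_of_le_lconvolution hα hc ht0 hVm hV_int hV_zero hV
  rw [hV_def, indicator_of_mem (right_mem_Ioc.2 ht0), ← ENNReal.ofReal_mul hat] at key
  refine (ENNReal.ofReal_le_ofReal_iff (mul_nonneg hat ?_)).1 key
  exact zero_le_one.trans (one_le_mittagLeffler hα hz)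
end

section
/- Let 0 < α < 1 and let δ̄ ≥ 0. Then ∫_0^∞ θ^{δ̄} M_α(θ) dθ = Γ(1 + δ̄) / Γ(1 + α δ̄), where M_α is the Wright function. -/
open MeasureTheory

/-- The Wright function
    `M_α(z) = ∑_{m=0}^∞ (−z)^m / (m! Γ(1 − α(m+1)))` for `0 < α < 1`. -/
noncomputable def wrightM (α z : ℝ) : ℝ :=
  ∑' m : ℕ, (-z) ^ m / ((m.factorial : ℝ) * Real.Gamma (1 - α * (m + 1)))

open Set Filter Topology

lemma tendsto_ofReal_punctured (x : ℝ) :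
    Tendsto (fun y : ℝ => (y : ℂ)) (𝓝[≠] x) (𝓝[≠] (x : ℂ)) :=
  (Complex.continuous_ofReal.tendsto x).inf (by simp)

/-- The real-exponent Gamma integrand with a complex rate in the right half plane is integrable. -/
lemma integrableOn_rpow_mul_cexp_neg_mul {a : ℝ} {r : ℂ} (ha : 0 < a) (hr : 0 < r.re) :
    IntegrableOn (fun t : ℝ => ((t ^ (a - 1) : ℝ) : ℂ) * Complex.exp (-(r * t))) (Ioi 0) := by
  have h := integrableOn_rpow_mul_exp_neg_mul_rpow (s := a - 1) (by linarith) one_pos hr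
  refine Integrable.mono' h (by fun_prop) ?_
  filter_upwards [ae_restrict_mem measurableSet_Ioi] with t (ht : 0 < t)
  have : 0 ≤ t ^ (a - 1) := by positivity
  simp [Complex.norm_exp, abs_of_nonneg this]

lemma differentiableOn_integral_rpow_mul_cexp_neg_mul {a : ℝ} (ha : 0 < a) :
    DifferentiableOn ℂ (fun r : ℂ => ∫ t in Ioi (0 : ℝ),
      ((t ^ (a - 1) : ℝ) : ℂ) * Complex.exp (-(r * t))) {r | 0 < r.re} := by
  intro r (hr : 0 < r.re)
  have hs : {z : ℂ | r.re / 2 < z.re} ∈ 𝓝 r :=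
    (isOpen_lt continuous_const Complex.continuous_re).mem_nhds (by simp; linarith)
  have hb := integrableOn_rpow_mul_exp_neg_mul_rpow (s := a) (by linarith) one_pos (half_pos hr)
  refine (hasDerivAt_integral_of_dominated_loc_of_deriv_le (μ := volume.restrict (Ioi 0))
    (F := fun z (t : ℝ) => ((t ^ (a - 1) : ℝ) : ℂ) * Complex.exp (-(z * t)))
    (F' := fun z (t : ℝ) => ((t ^ (a - 1) : ℝ) : ℂ) * (Complex.exp (-(z * t)) * -t)) hs
    (.of_forall fun z => by fun_prop) (integrableOn_rpow_mul_cexp_neg_mul ha hr)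
    (by fun_prop) ?_ hb ?_).2.differentiableAt.differentiableWithinAt
  · filter_upwards [ae_restrict_mem measurableSet_Ioi] with t (ht : 0 < t) z (hz : _ < z.re)
    have h1 : 0 ≤ t ^ (a - 1) := by positivity
    have h2 : t ^ a = t ^ (a - 1) * t := by
      rw [Real.rpow_sub_one ht.ne']; field_simp
    have h3 : Real.exp (-(z.re * t)) ≤ Real.exp (-(r.re / 2) * t ^ (1 : ℝ)) := by
      rw [Real.exp_le_exp, Real.rpow_one]; nlinarith
    simp only [norm_mul, Complex.norm_real, Real.norm_eq_abs, abs_of_nonneg h1, Complex.norm_exp,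
      norm_neg, abs_of_pos ht, h2]
    simp only [Complex.neg_re, Complex.mul_re, Complex.ofReal_re, Complex.ofReal_im, mul_zero,
      sub_zero]
    calc _ = (t ^ (a - 1) * t) * Real.exp (-(z.re * t)) := by ring
      _ ≤ _ := by gcongr
  · filter_upwards with t z _
    refine HasDerivAt.const_mul _ (HasDerivAt.cexp ?_)
    simpa using! ((hasDerivAt_id z).mul_const (t : ℂ)).neg

/-- The Gamma integral with a complex rate in the right half plane. -/
lemma integral_rpow_mul_cexp_neg_mul {a : ℝ} {r : ℂ} (ha : 0 < a) (hr : 0 < r.re) :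
    ∫ t in Ioi (0 : ℝ), ((t ^ (a - 1) : ℝ) : ℂ) * Complex.exp (-(r * t)) =
      r ^ (-(a : ℂ)) * Real.Gamma a := by
  have ho : IsOpen {r : ℂ | 0 < r.re} := isOpen_lt continuous_const Complex.continuous_re
  have hR : DifferentiableOn ℂ (fun r : ℂ => r ^ (-(a : ℂ)) * Real.Gamma a) {r | 0 < r.re} :=
    fun z (hz : 0 < z.re) => (((differentiableAt_id.cpow_const (Or.inl hz)).mul_const
      _).differentiableWithinAt)
  refine AnalyticOnNhd.eqOn_of_preconnected_of_frequently_eq (z₀ := 1)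
    ((differentiableOn_integral_rpow_mul_cexp_neg_mul ha).analyticOnNhd ho)
    (hR.analyticOnNhd ho) (convex_halfSpace_re_gt 0).isPreconnected (by simp) ?_ hr
  have ht : Tendsto (fun x : ℝ => (x : ℂ)) (𝓝[≠] 1) (𝓝[≠] 1) := by
    simpa using tendsto_ofReal_punctured 1
  refine ht.frequently (Eventually.frequently ?_)
  filter_upwards [mem_nhdsWithin_of_mem_nhds (Ioi_mem_nhds one_pos)] with x (hx : 0 < x)
  have h := Complex.integral_cpow_mul_exp_neg_mul_Ioi (a := a) (by simpa using ha) hx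
  rw [Complex.Gamma_ofReal, one_div, ← Complex.ofReal_inv, ← Complex.ofReal_cpow (by positivity),
    Real.inv_rpow hx.le, ← Real.rpow_neg hx.le, Complex.ofReal_cpow hx.le] at h
  push_cast at h
  rw [← h]
  refine setIntegral_congr_fun measurableSet_Ioi fun t (ht : 0 < t) => ?_
  simp [Complex.ofReal_cpow ht.le]

/-- Sublinear exponential growth does not spoil integrability of the Gamma integrand. -/
lemma integrableOn_rpow_mul_exp_neg_mul_mul_exp_rpow {a p b c : ℝ} (ha : 0 < a) (hp0 : 0 < p)
    (hp1 : p < 1) (hb : 0 ≤ b) (hc : 0 < c) :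
    IntegrableOn (fun t : ℝ => t ^ (a - 1) * Real.exp (-(c * t)) * Real.exp (b * t ^ p))
      (Ioi 0) := by
  obtain ⟨K, hK⟩ : ∃ K, ∀ t > 0, b * t ^ p ≤ c / 2 * t + K := by
    have h : Tendsto (fun t : ℝ => b * t ^ (-(1 - p))) atTop (𝓝 (b * 0)) :=
      (tendsto_rpow_neg_atTop (by linarith)).const_mul b
    rw [mul_zero] at h
    obtain ⟨T, hT⟩ := eventually_atTop.1 (h.eventually_le_const (half_pos hc))
    refine ⟨b * |T| ^ p, fun t ht => ?_⟩
    rcases le_total T t with hTt | hTt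
    · have h1 := hT t hTt
      have h2 : t ^ p = t ^ (-(1 - p)) * t := by
        rw [show -(1 - p) = p - 1 by ring, Real.rpow_sub_one ht.ne']; field_simp
      have h3 : 0 ≤ b * |T| ^ p := by positivity
      rw [h2]
      nlinarith
    · have : t ^ p ≤ |T| ^ p := Real.rpow_le_rpow ht.le (hTt.trans (le_abs_self T)) hp0.le
      nlinarith [mul_pos (half_pos hc) ht, mul_le_mul_of_nonneg_left this hb]
  have h := (integrableOn_rpow_mul_exp_neg_mul_rpow (s := a - 1) (by linarith) one_pos
    (half_pos hc)).const_mul (Real.exp K)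
  refine Integrable.mono' h (by fun_prop) ?_
  filter_upwards [ae_restrict_mem measurableSet_Ioi] with t (ht : 0 < t)
  rw [Real.norm_of_nonneg (by positivity), mul_assoc, ← Real.exp_add, mul_left_comm,
    ← Real.exp_add, Real.rpow_one]
  refine mul_le_mul_of_nonneg_left (Real.exp_le_exp.2 ?_) (by positivity)
  linarith [hK t ht]

/-- The angle of the ray on which the integral representation of the Wright function lives. -/
noncomputable def wrightAngle (α : ℝ) : ℝ := Real.pi * α / (1 + α)

/-- The unit vector with argument `wrightAngle α`. -/
noncomputable def wrightDir (α : ℝ) : ℂ := Complex.exp (wrightAngle α * Complex.I)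

lemma wrightAngle_pos {α : ℝ} (hα0 : 0 < α) : 0 < wrightAngle α := by
  unfold wrightAngle; positivity

lemma wrightAngle_lt {α : ℝ} (hα0 : 0 < α) (hα1 : α < 1) : wrightAngle α < Real.pi / 2 := by
  unfold wrightAngle
  rw [div_lt_div_iff₀ (by linarith) two_pos]
  nlinarith [Real.pi_pos]

lemma wrightDir_re (α : ℝ) : (wrightDir α).re = Real.cos (wrightAngle α) := by
  simp [wrightDir, Complex.exp_ofReal_mul_I_re]

lemma norm_wrightDir (α : ℝ) : ‖wrightDir α‖ = 1 := by
  simp [wrightDir, Complex.norm_exp_ofReal_mul_I]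

lemma wrightDir_ne_zero (α : ℝ) : wrightDir α ≠ 0 := Complex.exp_ne_zero _

lemma wrightDir_re_pos {α : ℝ} (hα0 : 0 < α) (hα1 : α < 1) : 0 < (wrightDir α).re := by
  rw [wrightDir_re]
  exact Real.cos_pos_of_mem_Ioo
    ⟨by linarith [wrightAngle_pos hα0, Real.pi_pos], wrightAngle_lt hα0 hα1⟩

lemma wrightDir_inv_re (α : ℝ) : (wrightDir α)⁻¹.re = (wrightDir α).re := by
  simp [Complex.inv_re, Complex.normSq_eq_norm_sq, norm_wrightDir]

lemma wrightDir_cpow {α : ℝ} (hα0 : 0 < α) (hα1 : α < 1) (x : ℝ) :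
    wrightDir α ^ (x : ℂ) = Complex.exp ((x * wrightAngle α : ℝ) * Complex.I) := by
  have h0 := wrightAngle_pos hα0
  have h1 := wrightAngle_lt hα0 hα1
  have hπ := Real.pi_pos
  rw [Complex.cpow_def_of_ne_zero (wrightDir_ne_zero α), wrightDir,
    Complex.log_exp (by simp; linarith) (by simp; linarith)]
  push_cast
  ring_nf

lemma wrightDir_inv_cpow {α : ℝ} (hα0 : 0 < α) (hα1 : α < 1) (x : ℝ) :
    (wrightDir α)⁻¹ ^ (-(x : ℂ)) = Complex.exp ((x * wrightAngle α : ℝ) * Complex.I) := by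
  rw [Complex.inv_cpow, Complex.cpow_neg, inv_inv, wrightDir_cpow hα0 hα1]
  intro h
  have h2 := wrightDir_re_pos hα0 hα1
  rw [Complex.arg_eq_pi_iff] at h
  linarith

lemma wrightDir_pow (α : ℝ) (n : ℕ) :
    wrightDir α ^ n = Complex.exp ((n * wrightAngle α : ℝ) * Complex.I) := by
  rw [wrightDir, ← Complex.exp_nat_mul]
  push_cast
  ring_nf

/-- The integrand of the ray representation of the Wright function. -/
noncomputable def wrightKernel (α θ t : ℝ) : ℂ :=
  ((t ^ (α - 1) : ℝ) : ℂ) * Complex.exp (-((wrightDir α)⁻¹ * t)) *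
    Complex.exp (-(θ * wrightDir α * ((t ^ α : ℝ) : ℂ)))

lemma norm_wrightKernel {α θ t : ℝ} (ht : 0 < t) :
    ‖wrightKernel α θ t‖ = t ^ (α - 1) * Real.exp (-((wrightDir α).re * t)) *
      Real.exp (-(θ * (wrightDir α).re * t ^ α)) := by
  have h : 0 ≤ t ^ (α - 1) := by positivity
  simp only [wrightKernel, norm_mul, Complex.norm_real, Real.norm_of_nonneg h, Complex.norm_exp,
    Complex.neg_re, Complex.re_mul_ofReal, Complex.re_ofReal_mul, wrightDir_inv_re]

lemma measurable_wrightKernel (α : ℝ) : Measurable (Function.uncurry (wrightKernel α)) := by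
  unfold wrightKernel Function.uncurry
  fun_prop

lemma hasSum_integral_wrightKernel {α : ℝ} (hα0 : 0 < α) (hα1 : α < 1) (θ : ℝ) :
    HasSum (fun m : ℕ => (-(θ * wrightDir α)) ^ m / (m.factorial : ℂ) *
        (Complex.exp ((α * (m + 1) * wrightAngle α : ℝ) * Complex.I) * Real.Gamma (α * (m + 1))))
      (∫ t in Ioi (0 : ℝ), wrightKernel α θ t) := by
  have hc := wrightDir_re_pos hα0 hα1
  have key : HasSum (fun m : ℕ => ∫ t in Ioi (0 : ℝ), ((t ^ (α - 1) : ℝ) : ℂ) *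
      Complex.exp (-((wrightDir α)⁻¹ * t)) *
        ((-(θ * wrightDir α * ((t ^ α : ℝ) : ℂ))) ^ m / (m.factorial : ℂ)))
      (∫ t in Ioi (0 : ℝ), wrightKernel α θ t) := by
    have hsum (t : ℝ) : HasSum (fun m : ℕ => t ^ (α - 1) *
        Real.exp (-((wrightDir α).re * t)) * ((|θ| * t ^ α) ^ m / (m.factorial : ℝ)))
        (t ^ (α - 1) * Real.exp (-((wrightDir α).re * t)) * Real.exp (|θ| * t ^ α)) := by
      refine HasSum.mul_left _ ?_
      rw [Real.exp_eq_exp_ℝ]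
      exact NormedSpace.expSeries_div_hasSum_exp (|θ| * t ^ α)
    refine hasSum_integral_of_dominated_convergence
      (fun m t => t ^ (α - 1) * Real.exp (-((wrightDir α).re * t)) *
        ((|θ| * t ^ α) ^ m / (m.factorial : ℝ))) (fun m => by fun_prop) (fun m => ?_)
      (.of_forall fun t => (hsum t).summable) ?_ (.of_forall fun t => ?_)
    · filter_upwards [ae_restrict_mem measurableSet_Ioi] with t (ht : 0 < t)
      have h : 0 ≤ t ^ (α - 1) := by positivity
      have h' : 0 ≤ t ^ α := by positivity
      simp only [norm_mul, norm_div, norm_pow, norm_neg, Complex.norm_real, Real.norm_of_nonneg h,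
        Real.norm_of_nonneg h', Complex.norm_exp, Complex.neg_re, Complex.re_mul_ofReal,
        wrightDir_inv_re, norm_wrightDir, Complex.norm_natCast, mul_one, Real.norm_eq_abs, le_refl]
    · simp_rw [fun t => (hsum t).tsum_eq]
      exact integrableOn_rpow_mul_exp_neg_mul_mul_exp_rpow hα0 hα0 hα1 (abs_nonneg θ) hc
    · refine HasSum.mul_left _ ?_
      rw [Complex.exp_eq_exp_ℂ]
      exact NormedSpace.expSeries_div_hasSum_exp _
  convert key using 2 with m
  have ha : 0 < α * (m + 1) := by positivity
  rw [← wrightDir_inv_cpow hα0 hα1, ← integral_rpow_mul_cexp_neg_mul ha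
    (by rwa [wrightDir_inv_re]), ← integral_const_mul]
  refine setIntegral_congr_fun measurableSet_Ioi fun t (ht : 0 < t) => ?_
  have : t ^ (α * (m + 1) - 1) = t ^ (α - 1) * (t ^ α) ^ m := by
    rw [← Real.rpow_mul_natCast ht.le, ← Real.rpow_add ht]; ring_nf
  simp only [this]
  push_cast
  rw [← neg_mul, mul_pow]
  ring

/-- The reflection formula solved for the reciprocal Gamma function. -/
lemma Real.Gamma_mul_sin_eq {x : ℝ} (hx : 0 < x) :
    Real.Gamma x * Real.sin (Real.pi * x) = Real.pi / Real.Gamma (1 - x) := by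
  have h := Real.Gamma_mul_Gamma_one_sub x
  have hG := (Real.Gamma_pos_of_pos hx).ne'
  by_cases hs : Real.sin (Real.pi * x) = 0
  · rw [hs, div_zero] at h
    simp [hs, (mul_eq_zero.1 h).resolve_left hG]
  · have hG' : Real.Gamma (1 - x) ≠ 0 := fun h0 => by
      rw [h0, mul_zero] at h
      exact div_ne_zero Real.pi_ne_zero hs h.symm
    rw [eq_div_iff hs] at h
    rw [eq_div_iff hG']
    linarith

lemma wrightAngle_mul_one_add {α : ℝ} (hα0 : 0 < α) :
    wrightAngle α * (1 + α) = Real.pi * α := by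
  unfold wrightAngle
  field_simp

/-- The Wright function as the imaginary part of an integral along a ray. -/
lemma pi_mul_wrightM {α : ℝ} (hα0 : 0 < α) (hα1 : α < 1) (θ : ℝ) :
    Real.pi * wrightM α θ = (wrightDir α * ∫ t in Ioi (0 : ℝ), wrightKernel α θ t).im := by
  have h := Complex.hasSum_im ((hasSum_integral_wrightKernel hα0 hα1 θ).mul_left (wrightDir α))
  rw [← h.tsum_eq, wrightM, ← tsum_mul_left]
  refine tsum_congr fun m => ?_
  have ha : 0 < α * (m + 1) := by positivity
  have hg := Real.Gamma_mul_sin_eq ha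
  have : wrightDir α * ((-(θ * wrightDir α)) ^ m / (m.factorial : ℂ) *
        (Complex.exp ((α * (m + 1) * wrightAngle α : ℝ) * Complex.I) * Real.Gamma (α * (m + 1))))
      = (((-θ) ^ m / m.factorial * Real.Gamma (α * (m + 1)) : ℝ) : ℂ) *
        Complex.exp ((Real.pi * (α * (m + 1)) : ℝ) * Complex.I) := by
    have e : Complex.exp ((Real.pi * (α * (m + 1)) : ℝ) * Complex.I) =
        wrightDir α ^ (m + 1) *
          Complex.exp ((α * (m + 1) * wrightAngle α : ℝ) * Complex.I) := by
      rw [wrightDir_pow, ← Complex.exp_add, ← add_mul, ← Complex.ofReal_add]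
      congr 3
      have := wrightAngle_mul_one_add hα0
      push_cast
      linear_combination (-(m + 1 : ℝ)) * this
    rw [e, ← neg_mul, mul_pow]
    push_cast
    ring
  rw [this, Complex.im_ofReal_mul, Complex.exp_ofReal_mul_I_im, mul_assoc, hg]
  field_simp

/-- The Taylor remainder of the exponential on the left half plane is bounded by a multiple of the
first omitted power. -/
lemma exists_norm_exp_sub_sum_le (N : ℕ) : ∃ C : ℝ, ∀ z : ℂ, z.re ≤ 0 →
    ‖Complex.exp z - ∑ k ∈ Finset.range N, z ^ k / (k.factorial : ℂ)‖ ≤ C * ‖z‖ ^ N := by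
  refine ⟨Real.exp 1 + (1 + N), fun z hz => ?_⟩
  have hp : 0 ≤ ‖z‖ ^ N := by positivity
  rw [add_mul]
  rcases le_total ‖z‖ 1 with h | h
  · have h1 := Complex.norm_exp_sub_sum_le_norm_mul_exp z N
    have h2 : ‖z‖ ^ N * Real.exp ‖z‖ ≤ Real.exp 1 * ‖z‖ ^ N := by
      rw [mul_comm]; gcongr
    have h3 : 0 ≤ (1 + (N : ℝ)) * ‖z‖ ^ N := by positivity
    linarith
  · have h1 : ‖Complex.exp z‖ ≤ ‖z‖ ^ N := by
      rw [Complex.norm_exp]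
      exact (Real.exp_le_one_iff.2 hz).trans (one_le_pow₀ h)
    have h2 : ‖∑ k ∈ Finset.range N, z ^ k / (k.factorial : ℂ)‖ ≤ N * ‖z‖ ^ N := by
      have : ∀ k ∈ Finset.range N, ‖z ^ k / (k.factorial : ℂ)‖ ≤ ‖z‖ ^ N := fun k hk => by
        rw [norm_div, norm_pow, Complex.norm_natCast]
        refine (div_le_self (by positivity) ?_).trans
          (pow_le_pow_right₀ h (Finset.mem_range.1 hk).le)
        exact_mod_cast k.factorial_pos
      simpa using norm_sum_le_of_le _ this
    have h3 := norm_sub_le (Complex.exp z) (∑ k ∈ Finset.range N, z ^ k / (k.factorial : ℂ))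
    have h4 : 0 ≤ Real.exp 1 * ‖z‖ ^ N := by positivity
    linarith

lemma integrableOn_rpow_mul_cexp_neg_mul_rpow {p q : ℝ} {r : ℂ} (hp : 0 < p) (hq : -1 < q)
    (hr : 0 < r.re) :
    IntegrableOn (fun t : ℝ => ((t ^ q : ℝ) : ℂ) * Complex.exp (-(r * ((t ^ p : ℝ) : ℂ))))
      (Ioi 0) := by
  refine Integrable.mono' (integrableOn_rpow_mul_exp_neg_mul_rpow hq hp hr) (by fun_prop) ?_
  filter_upwards [ae_restrict_mem measurableSet_Ioi] with t (ht : 0 < t)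
  have h : 0 ≤ t ^ q := by positivity
  simp only [norm_mul, Complex.norm_real, Real.norm_of_nonneg h, Complex.norm_exp,
    Complex.neg_re, Complex.re_mul_ofReal, neg_mul, le_refl]

lemma integral_rpow_mul_cexp_neg_mul_rpow {p q : ℝ} {r : ℂ} (hp : 0 < p) (hq : -1 < q)
    (hr : 0 < r.re) :
    ∫ t in Ioi (0 : ℝ), ((t ^ q : ℝ) : ℂ) * Complex.exp (-(r * ((t ^ p : ℝ) : ℂ))) =
      (p : ℂ)⁻¹ * (r ^ (-(((q + 1) / p : ℝ) : ℂ)) * Real.Gamma ((q + 1) / p)) := by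
  have ha : 0 < (q + 1) / p := div_pos (by linarith) hp
  have hsub := integral_comp_rpow_Ioi (fun u : ℝ => ((u ^ ((q + 1) / p - 1) : ℝ) : ℂ) *
    Complex.exp (-(r * u))) hp.ne'
  rw [← integral_rpow_mul_cexp_neg_mul ha hr, ← hsub, ← integral_const_mul]
  refine setIntegral_congr_fun measurableSet_Ioi fun t (ht : 0 < t) => ?_
  have h : t ^ q = t ^ (p - 1) * (t ^ p) ^ ((q + 1) / p - 1) := by
    rw [← Real.rpow_mul ht.le, ← Real.rpow_add ht]
    congr 1
    field_simp
    ring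
  have hp' : (p : ℂ) ≠ 0 := by exact_mod_cast hp.ne'
  simp only [h, abs_of_pos hp, Complex.real_smul]
  push_cast
  field_simp

lemma ofReal_mul_wrightDir_cpow {α : ℝ} (hα0 : 0 < α) (hα1 : α < 1) {θ : ℝ} (hθ : 0 < θ) (x : ℝ) :
    (θ * wrightDir α) ^ (x : ℂ) =
      ((θ ^ x : ℝ) : ℂ) * Complex.exp ((x * wrightAngle α : ℝ) * Complex.I) := by
  have hθ' : (θ : ℂ) ≠ 0 := by exact_mod_cast hθ.ne'
  rw [← wrightDir_cpow hα0 hα1, Complex.ofReal_cpow hθ.le,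
    Complex.cpow_def_of_ne_zero (mul_ne_zero hθ' (wrightDir_ne_zero α)),
    Complex.cpow_def_of_ne_zero hθ', Complex.cpow_def_of_ne_zero (wrightDir_ne_zero α),
    Complex.log_ofReal_mul hθ (wrightDir_ne_zero α), ← Complex.ofReal_log hθ.le, add_mul,
    Complex.exp_add]

/-- The Taylor terms of the ray integral at the origin do not contribute to the imaginary part. -/
lemma im_wrightDir_mul_integral_eq_zero {α : ℝ} (hα0 : 0 < α) (hα1 : α < 1) {θ : ℝ} (hθ : 0 < θ)
    (k : ℕ) :
    (wrightDir α * ∫ t in Ioi (0 : ℝ), ((t ^ (α - 1 + k) : ℝ) : ℂ) *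
      Complex.exp (-(θ * wrightDir α * ((t ^ α : ℝ) : ℂ))) * (-(wrightDir α)⁻¹) ^ k).im = 0 := by
  have hre : 0 < (θ * wrightDir α).re := by
    rw [Complex.re_ofReal_mul]
    exact mul_pos hθ (wrightDir_re_pos hα0 hα1)
  have hk : (0 : ℝ) ≤ k := k.cast_nonneg
  rw [integral_mul_const, integral_rpow_mul_cexp_neg_mul_rpow hα0 (by linarith) hre,
    ← Complex.ofReal_neg, ofReal_mul_wrightDir_cpow hα0 hα1 hθ]
  set b : ℝ := (α - 1 + k + 1) / α with hb
  have e : wrightDir α * Complex.exp ((-b * wrightAngle α : ℝ) * Complex.I) *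
      (-(wrightDir α)⁻¹) ^ k = 1 := by
    rw [neg_pow, inv_pow, wrightDir_pow, ← Complex.exp_neg, wrightDir, ← Complex.exp_add,
      mul_left_comm, ← Complex.exp_add]
    have : (wrightAngle α : ℂ) * Complex.I + (-b * wrightAngle α : ℝ) * Complex.I +
        -((k * wrightAngle α : ℝ) * Complex.I) = -(k * (Real.pi * Complex.I)) := by
      have h1 := wrightAngle_mul_one_add hα0
      have h2 : wrightAngle α - b * wrightAngle α - k * wrightAngle α = - (k * Real.pi) := by
        rw [hb]
        field_simp
        linear_combination (-(k : ℝ)) * h1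
      have h3 := congrArg (fun x : ℝ => (x : ℂ) * Complex.I) h2
      push_cast at h3 ⊢
      linear_combination h3
    rw [this, Complex.exp_neg, Complex.exp_nat_mul, Complex.exp_pi_mul_I, ← inv_pow, ← mul_pow]
    norm_num
  have : ∀ x y z : ℂ, wrightDir α * (x * (y * Complex.exp ((-b * wrightAngle α : ℝ) * Complex.I)
      * z) * (-(wrightDir α)⁻¹) ^ k) = x * y * z := fun x y z => by
    linear_combination (x * y * z) * e
  rw [this, ← Complex.ofReal_inv, ← Complex.ofReal_mul, ← Complex.ofReal_mul, Complex.ofReal_im]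

/-- The Wright function decays faster than every power. -/
lemma exists_abs_wrightM_le {α : ℝ} (hα0 : 0 < α) (hα1 : α < 1) (N : ℕ) :
    ∃ C : ℝ, ∀ θ > 0, |wrightM α θ| ≤ C * θ ^ (-((α + N) / α)) := by
  obtain ⟨C, hC⟩ := exists_norm_exp_sub_sum_le N
  have hc := wrightDir_re_pos hα0 hα1
  set w := wrightDir α
  have hN : (0 : ℝ) ≤ N := N.cast_nonneg
  refine ⟨Real.pi⁻¹ * (C * (w.re ^ (-((α + N) / α)) * (1 / α) * Real.Gamma ((α + N) / α))),
    fun θ hθ => ?_⟩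
  have hre : 0 < (θ * w).re := by
    rw [Complex.re_ofReal_mul]
    exact mul_pos hθ hc
  let g : ℕ → ℝ → ℂ := fun k t => ((t ^ (α - 1 + k) : ℝ) : ℂ) *
      Complex.exp (-(θ * w * ((t ^ α : ℝ) : ℂ))) * (-w⁻¹) ^ k
  have hg (k : ℕ) : IntegrableOn (g k) (Ioi 0) := by
    have hk : (0 : ℝ) ≤ k := k.cast_nonneg
    exact (integrableOn_rpow_mul_cexp_neg_mul_rpow hα0 (by linarith) hre).mul_const _
  have hK : IntegrableOn (wrightKernel α θ) (Ioi 0) := by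
    have h := integrableOn_rpow_mul_exp_neg_mul_rpow (s := α - 1) (by linarith) one_pos hc
    refine Integrable.mono' h
      ((measurable_wrightKernel α).comp measurable_prodMk_left).aestronglyMeasurable ?_
    filter_upwards [ae_restrict_mem measurableSet_Ioi] with t (ht : 0 < t)
    rw [norm_wrightKernel ht, Real.rpow_one, neg_mul]
    refine mul_le_of_le_one_right (by positivity) (Real.exp_le_one_iff.2 ?_)
    exact neg_nonpos.2 (by positivity)
  have him : Real.pi * wrightM α θ = (w * ∫ t in Ioi (0 : ℝ), (wrightKernel α θ t -
      ∑ k ∈ Finset.range N, (k.factorial : ℂ)⁻¹ * g k t)).im := by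
    rw [pi_mul_wrightM hα0 hα1, integral_sub hK
      (integrable_finsetSum _ fun k _ => (hg k).const_mul _),
      integral_finsetSum _ fun k _ => (hg k).const_mul _, mul_sub, Complex.sub_im,
      Finset.mul_sum, Complex.im_sum, Finset.sum_eq_zero, sub_zero]
    intro k _
    rw [integral_const_mul, mul_left_comm, ← Complex.ofReal_natCast, ← Complex.ofReal_inv,
      Complex.im_ofReal_mul, im_wrightDir_mul_integral_eq_zero hα0 hα1 hθ, mul_zero]
  have hbound : ∀ t > 0, ‖wrightKernel α θ t -
      ∑ k ∈ Finset.range N, (k.factorial : ℂ)⁻¹ * g k t‖ ≤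
        C * (t ^ (α - 1 + N) * Real.exp (-(w.re * θ) * t ^ α)) := by
    intro t ht
    have e : wrightKernel α θ t - ∑ k ∈ Finset.range N, (k.factorial : ℂ)⁻¹ * g k t =
        ((t ^ (α - 1) : ℝ) : ℂ) * Complex.exp (-(θ * w * ((t ^ α : ℝ) : ℂ))) *
          (Complex.exp (-(w⁻¹ * t)) -
            ∑ k ∈ Finset.range N, (-(w⁻¹ * t)) ^ k / (k.factorial : ℂ)) := by
      rw [mul_sub, Finset.mul_sum, wrightKernel]
      congr 1
      · ring
      · refine Finset.sum_congr rfl fun k _ => ?_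
        simp only [g, Real.rpow_add ht, Real.rpow_natCast]
        push_cast
        rw [← neg_mul w⁻¹, mul_pow (-w⁻¹)]
        ring
    have h1 : 0 ≤ t ^ (α - 1) := by positivity
    have h2 := hC (-(w⁻¹ * t)) (by
      rw [Complex.neg_re, Complex.re_mul_ofReal, wrightDir_inv_re]
      exact neg_nonpos.2 (by positivity))
    rw [norm_neg, norm_mul, norm_inv, norm_wrightDir, inv_one, one_mul, Complex.norm_real,
      Real.norm_of_nonneg ht.le] at h2
    rw [e, norm_mul, norm_mul, Complex.norm_real, Real.norm_of_nonneg h1, Complex.norm_exp,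
      Complex.neg_re, Complex.re_mul_ofReal, Complex.re_ofReal_mul, Real.rpow_add ht,
      Real.rpow_natCast, neg_mul, mul_comm w.re θ]
    calc _ ≤ t ^ (α - 1) * Real.exp (-(θ * w.re * t ^ α)) * (C * t ^ N) := by gcongr
      _ = _ := by ring
  have hint : IntegrableOn (fun t : ℝ => C * (t ^ (α - 1 + N) *
      Real.exp (-(w.re * θ) * t ^ α))) (Ioi 0) :=
    (integrableOn_rpow_mul_exp_neg_mul_rpow (by linarith) hα0 (by positivity)).const_mul C
  have hfin : Real.pi * |wrightM α θ| ≤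
      C * (w.re ^ (-((α + N) / α)) * (1 / α) * Real.Gamma ((α + N) / α)) *
        θ ^ (-((α + N) / α)) := by
    rw [show Real.pi * |wrightM α θ| = |Real.pi * wrightM α θ| by
      rw [abs_mul, abs_of_pos Real.pi_pos], him]
    refine (Complex.abs_im_le_norm _).trans ?_
    rw [norm_mul, norm_wrightDir, one_mul]
    refine (norm_integral_le_of_norm_le hint ?_).trans_eq ?_
    · filter_upwards [ae_restrict_mem measurableSet_Ioi] with t ht using hbound t ht
    · rw [integral_const_mul, integral_rpow_mul_exp_neg_mul_rpow hα0 (by linarith) (by positivity),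
        Real.mul_rpow hc.le hθ.le, show α - 1 + N + 1 = α + N by ring, neg_div]
      ring
  rw [mul_assoc, ← div_eq_inv_mul, le_div_iff₀ Real.pi_pos]
  linarith

lemma continuousOn_wrightM {α : ℝ} (hα0 : 0 < α) (hα1 : α < 1) :
    ContinuousOn (wrightM α) (Ici 0) := by
  have hc := wrightDir_re_pos hα0 hα1
  have h : ContinuousOn (fun θ => ∫ t in Ioi (0 : ℝ), wrightKernel α θ t) (Ici 0) := by
    refine continuousOn_of_dominated
      (fun θ _ => ((measurable_wrightKernel α).comp measurable_prodMk_left).aestronglyMeasurable)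
      (fun θ (hθ : 0 ≤ θ) => ?_)
      (integrableOn_rpow_mul_exp_neg_mul_rpow (s := α - 1) (by linarith) one_pos hc)
      (.of_forall fun t => Continuous.continuousOn ?_)
    · filter_upwards [ae_restrict_mem measurableSet_Ioi] with t (ht : 0 < t)
      rw [norm_wrightKernel ht, Real.rpow_one, neg_mul]
      refine mul_le_of_le_one_right (by positivity) (Real.exp_le_one_iff.2 ?_)
      exact neg_nonpos.2 (by positivity)
    · unfold wrightKernel
      fun_prop
  have h' := (Complex.continuous_im.comp_continuousOn
    (continuousOn_const (c := wrightDir α).mul h)).const_smul Real.pi⁻¹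
  refine h'.congr fun θ _ => ?_
  change wrightM α θ = Real.pi⁻¹ * (wrightDir α * _).im
  rw [← pi_mul_wrightM hα0 hα1 θ, inv_mul_cancel_left₀ Real.pi_ne_zero]

lemma integrable_rpow_mul_wrightKernel {α s : ℝ} (hα0 : 0 < α) (hα1 : α < 1) (hs0 : 0 < s)
    (hs1 : s < 1) :
    Integrable (Function.uncurry fun θ t : ℝ => ((θ ^ (s - 1) : ℝ) : ℂ) * wrightKernel α θ t)
      ((volume.restrict (Ioi 0)).prod (volume.restrict (Ioi 0))) := by
  have hc := wrightDir_re_pos hα0 hα1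
  set c := (wrightDir α).re
  have hm : Measurable
      (Function.uncurry fun θ t : ℝ => ((θ ^ (s - 1) : ℝ) : ℂ) * wrightKernel α θ t) := by
    refine Measurable.mul (f := fun p : ℝ × ℝ => ((p.1 ^ (s - 1) : ℝ) : ℂ)) (by fun_prop)
      (measurable_wrightKernel α)
  have hnorm {θ t : ℝ} (hθ : 0 < θ) (ht : 0 < t) :
      ‖((θ ^ (s - 1) : ℝ) : ℂ) * wrightKernel α θ t‖ = t ^ (α - 1) * Real.exp (-(c * t)) *
        (θ ^ (s - 1) * Real.exp (-(c * t ^ α * θ))) := by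
    rw [norm_mul, norm_wrightKernel ht, Complex.norm_real,
      Real.norm_of_nonneg (by positivity : 0 ≤ θ ^ (s - 1)),
      show θ * c * t ^ α = c * t ^ α * θ by ring]
    ring
  rw [integrable_prod_iff' hm.aestronglyMeasurable]
  constructor
  · filter_upwards [ae_restrict_mem measurableSet_Ioi] with t (ht : 0 < t)
    have hi := (integrableOn_rpow_mul_exp_neg_mul_rpow (s := s - 1) (p := 1) (b := c * t ^ α)
      (by linarith) one_pos (by positivity)).const_mul (t ^ (α - 1) * Real.exp (-(c * t)))
    refine Integrable.mono' hi (hm.comp measurable_prodMk_right).aestronglyMeasurable ?_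
    filter_upwards [ae_restrict_mem measurableSet_Ioi] with θ (hθ : 0 < θ)
    simp only [Function.uncurry]
    rw [hnorm hθ ht, Real.rpow_one, neg_mul]
  · have hpos : -1 < α * (1 - s) - 1 := by
      have : 0 < α * (1 - s) := mul_pos hα0 (by linarith)
      linarith
    have hi : IntegrableOn _ _ _ := (integrableOn_rpow_mul_exp_neg_mul_rpow hpos one_pos hc).const_mul
      ((1 / c) ^ s * Real.Gamma s)
    refine hi.congr_fun (fun t (ht : 0 < t) => ?_) measurableSet_Ioi
    have : ∫ θ in Ioi (0 : ℝ), ‖((θ ^ (s - 1) : ℝ) : ℂ) * wrightKernel α θ t‖ =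
        ∫ θ in Ioi (0 : ℝ), t ^ (α - 1) * Real.exp (-(c * t)) *
          (θ ^ (s - 1) * Real.exp (-(c * t ^ α * θ))) :=
      setIntegral_congr_fun measurableSet_Ioi fun θ hθ => hnorm hθ ht
    simp only [Function.uncurry]
    rw [this, integral_const_mul, Real.integral_rpow_mul_exp_neg_mul_Ioi hs0 (by positivity),
      one_div, one_div, Real.inv_rpow hc.le, Real.inv_rpow (by positivity),
      Real.mul_rpow hc.le (by positivity), ← Real.rpow_mul ht.le,
      show α * (1 - s) - 1 = (α - 1) - α * s by ring, Real.rpow_sub ht, Real.rpow_one, neg_mul,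
      mul_inv]
    ring

/-- The moments of order between `-1` and `0` of the Wright function. -/
lemma integral_rpow_mul_wrightM_of_lt_one {α s : ℝ} (hα0 : 0 < α) (hα1 : α < 1) (hs0 : 0 < s)
    (hs1 : s < 1) :
    ∫ θ in Ioi (0 : ℝ), θ ^ (s - 1) * wrightM α θ =
      Real.Gamma s / Real.Gamma (1 - α * (1 - s)) := by
  have hc := wrightDir_re_pos hα0 hα1
  have ha : 0 < α * (1 - s) := mul_pos hα0 (by linarith)
  have hint := integrable_rpow_mul_wrightKernel hα0 hα1 hs0 hs1
  have hinner : ∀ t > 0, ∫ θ in Ioi (0 : ℝ), ((θ ^ (s - 1) : ℝ) : ℂ) * wrightKernel α θ t =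
      Real.Gamma s * Complex.exp ((-s * wrightAngle α : ℝ) * Complex.I) *
        (((t ^ (α * (1 - s) - 1) : ℝ) : ℂ) * Complex.exp (-((wrightDir α)⁻¹ * t))) := by
    intro t ht
    have hre : 0 < (((t ^ α : ℝ) : ℂ) * wrightDir α).re := by
      rw [Complex.re_ofReal_mul]; positivity
    have h := integral_rpow_mul_cexp_neg_mul hs0 hre
    rw [← Complex.ofReal_neg, ofReal_mul_wrightDir_cpow hα0 hα1 (by positivity),
      ← Real.rpow_mul ht.le] at h
    rw [show α * (1 - s) - 1 = (α - 1) + α * -s by ring, Real.rpow_add ht]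
    have : ∀ θ : ℝ, ((θ ^ (s - 1) : ℝ) : ℂ) * wrightKernel α θ t =
        ((t ^ (α - 1) : ℝ) : ℂ) * Complex.exp (-((wrightDir α)⁻¹ * t)) *
          (((θ ^ (s - 1) : ℝ) : ℂ) *
            Complex.exp (-(((t ^ α : ℝ) : ℂ) * wrightDir α * θ))) := fun θ => by
      rw [wrightKernel, show (θ : ℂ) * wrightDir α * ((t ^ α : ℝ) : ℂ) =
        ((t ^ α : ℝ) : ℂ) * wrightDir α * θ by ring]
      ring
    simp_rw [this]
    rw [integral_const_mul, h]
    push_cast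
    ring
  have hfub : wrightDir α * ∫ θ in Ioi (0 : ℝ), ∫ t in Ioi (0 : ℝ),
      ((θ ^ (s - 1) : ℝ) : ℂ) * wrightKernel α θ t =
        ((Real.Gamma s * Real.Gamma (α * (1 - s)) : ℝ) : ℂ) *
          Complex.exp ((Real.pi * (α * (1 - s)) : ℝ) * Complex.I) := by
    rw [integral_integral_swap hint, setIntegral_congr_fun measurableSet_Ioi hinner,
      integral_const_mul, integral_rpow_mul_cexp_neg_mul ha (by rwa [wrightDir_inv_re]),
      wrightDir_inv_cpow hα0 hα1]
    have e : Complex.exp ((Real.pi * (α * (1 - s)) : ℝ) * Complex.I) =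
        wrightDir α * Complex.exp ((-s * wrightAngle α : ℝ) * Complex.I) *
          Complex.exp ((α * (1 - s) * wrightAngle α : ℝ) * Complex.I) := by
      rw [wrightDir, ← Complex.exp_add, ← Complex.exp_add, ← add_mul, ← add_mul,
        ← Complex.ofReal_add, ← Complex.ofReal_add]
      congr 3
      linear_combination (-(1 - s)) * wrightAngle_mul_one_add hα0
    rw [e]
    push_cast
    ring
  have hint' : Integrable (fun θ : ℝ => wrightDir α * ∫ t in Ioi (0 : ℝ),
      ((θ ^ (s - 1) : ℝ) : ℂ) * wrightKernel α θ t) (volume.restrict (Ioi 0)) :=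
    hint.integral_prod_left.const_mul _
  have hπ : Real.pi * ∫ θ in Ioi (0 : ℝ), θ ^ (s - 1) * wrightM α θ =
      (wrightDir α * ∫ θ in Ioi (0 : ℝ), ∫ t in Ioi (0 : ℝ),
        ((θ ^ (s - 1) : ℝ) : ℂ) * wrightKernel α θ t).im := by
    rw [← integral_const_mul, ← integral_const_mul, ← Complex.imCLM_apply,
      ← ContinuousLinearMap.integral_comp_comm _ hint']
    refine setIntegral_congr_fun measurableSet_Ioi fun θ _ => ?_
    simp only [Complex.imCLM_apply]
    rw [mul_left_comm, pi_mul_wrightM hα0 hα1, integral_const_mul, mul_left_comm,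
      Complex.im_ofReal_mul]
  rw [hfub, Complex.im_ofReal_mul, Complex.exp_ofReal_mul_I_im, mul_assoc,
    Real.Gamma_mul_sin_eq ha] at hπ
  refine mul_left_cancel₀ Real.pi_ne_zero (hπ.trans ?_)
  ring

lemma mellin_wrightM_ofReal {α : ℝ} (s : ℝ) :
    mellin (fun θ => (wrightM α θ : ℂ)) s =
      ((∫ θ in Ioi (0 : ℝ), θ ^ (s - 1) * wrightM α θ : ℝ) : ℂ) := by
  rw [mellin, ← integral_complex_ofReal]
  refine setIntegral_congr_fun measurableSet_Ioi fun θ (hθ : 0 < θ) => ?_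
  simp [Complex.ofReal_cpow hθ.le]

lemma differentiableAt_mellin_wrightM {α : ℝ} (hα0 : 0 < α) (hα1 : α < 1) {s : ℂ}
    (hs : 0 < s.re) :
    DifferentiableAt ℂ (mellin fun θ => (wrightM α θ : ℂ)) s := by
  have hcont := continuousOn_wrightM hα0 hα1
  obtain ⟨N, hN⟩ := exists_nat_gt (α * s.re)
  obtain ⟨C, hC⟩ := exists_abs_wrightM_le hα0 hα1 N
  refine mellin_differentiableAt_of_isBigO_rpow (a := (α + N) / α) (b := 0) ?_ ?_ ?_ ?_ hs
  · exact ContinuousOn.locallyIntegrableOn (Complex.continuous_ofReal.comp_continuousOn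
      (hcont.mono Ioi_subset_Ici_self)) measurableSet_Ioi
  · refine Asymptotics.IsBigO.of_bound C ?_
    filter_upwards [eventually_gt_atTop 0] with θ hθ
    rw [Complex.norm_real, Real.norm_eq_abs,
      Real.norm_of_nonneg (by positivity : 0 ≤ θ ^ (-((α + N) / α)))]
    exact hC θ hθ
  · rw [lt_div_iff₀ hα0]
    linarith
  · have h : Tendsto (fun θ => (wrightM α θ : ℂ)) (𝓝[>] 0) (𝓝 (wrightM α 0)) :=
      (Complex.continuous_ofReal.tendsto _).comp
        ((hcont 0 self_mem_Ici).mono_left (nhdsWithin_mono _ Ioi_subset_Ici_self))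
    simpa using h.isBigO_one ℝ

/-- The Mellin transform of the Wright function. -/
lemma mellin_wrightM {α : ℝ} (hα0 : 0 < α) (hα1 : α < 1) {s : ℂ} (hs : 0 < s.re) :
    mellin (fun θ => (wrightM α θ : ℂ)) s =
      Complex.Gamma s * (Complex.Gamma (1 - α * (1 - s)))⁻¹ := by
  have ho : IsOpen {s : ℂ | 0 < s.re} := isOpen_lt continuous_const Complex.continuous_re
  have hL : DifferentiableOn ℂ (mellin fun θ => (wrightM α θ : ℂ)) {s | 0 < s.re} :=
    fun s hs => (differentiableAt_mellin_wrightM hα0 hα1 hs).differentiableWithinAt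
  have hR : DifferentiableOn ℂ
      (fun s : ℂ => Complex.Gamma s * (Complex.Gamma (1 - α * (1 - s)))⁻¹) {s | 0 < s.re} := by
    intro s (hs : 0 < s.re)
    refine (DifferentiableAt.mul (Complex.differentiableAt_Gamma s fun m h => ?_)
      ((Complex.differentiable_one_div_Gamma _).comp s (by fun_prop))).differentiableWithinAt
    have : (0 : ℝ) ≤ m := m.cast_nonneg
    rw [h] at hs
    simp at hs
    linarith
  refine AnalyticOnNhd.eqOn_of_preconnected_of_frequently_eq (z₀ := ((1 / 2 : ℝ) : ℂ))
    (hL.analyticOnNhd ho) (hR.analyticOnNhd ho) (convex_halfSpace_re_gt 0).isPreconnected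
    (by simp) ?_ hs
  have ht : Tendsto (fun x : ℝ => (x : ℂ)) (𝓝[≠] (1 / 2)) (𝓝[≠] ((1 / 2 : ℝ) : ℂ)) :=
    tendsto_ofReal_punctured _
  refine ht.frequently (Eventually.frequently ?_)
  filter_upwards [mem_nhdsWithin_of_mem_nhds
    (Ioo_mem_nhds (by norm_num : (0 : ℝ) < 1 / 2) (by norm_num : (1 / 2 : ℝ) < 1))] with x hx
  rw [mellin_wrightM_ofReal, integral_rpow_mul_wrightM_of_lt_one hα0 hα1 hx.1 hx.2,
    Complex.ofReal_div, ← Complex.Gamma_ofReal, ← Complex.Gamma_ofReal, div_eq_mul_inv]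
  push_cast
  rfl

/-- Moment formula for the Wright function:
    `∫_0^∞ θ^δ̄ M_α(θ) dθ = Γ(1 + δ̄) / Γ(1 + α δ̄)`. -/
theorem wright_moment (α δ : ℝ) (hα0 : 0 < α) (hα1 : α < 1) (hδ : 0 ≤ δ) :
    ∫ θ in Set.Ioi (0 : ℝ), θ ^ δ * wrightM α θ =
      Real.Gamma (1 + δ) / Real.Gamma (1 + α * δ) := by
  have h := mellin_wrightM hα0 hα1 (s := ((1 + δ : ℝ) : ℂ)) (by simp; linarith)
  rw [mellin_wrightM_ofReal, add_sub_cancel_left,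
    show (1 - α * (1 - ((1 + δ : ℝ) : ℂ)) : ℂ) = ((1 + α * δ : ℝ) : ℂ) by push_cast; ring,
    Complex.Gamma_ofReal, Complex.Gamma_ofReal, ← div_eq_mul_inv, ← Complex.ofReal_div] at h
  exact_mod_cast h
end
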